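/- arXiv:1309.0150 — 4 statements merged into one kernel-verified Lean document; each statement's English description precedes it below -/
import Mathlib

section
/- The sequence x = (xₖ) with xₖ = f_{k+1}² satisfies F̂x = e⁽⁰⁾ = (1,0,0,…), so x ∈ c₀(F̂) but x is unbounded; consequently neither c₀(F̂) nor c(F̂) is contained in the space ℓ∞ of bounded sequences. -/
open Filter Finset Topology

noncomputable section

/-- The Fibonacci sequence with `f 0 = f 1 = 1`, `f (n+2) = f (n+1) + f n`, as a real sequence. -/
def fibR (n : ℕ) : ℝ := (Nat.fib (n + 1) : ℝ)

/-- The Fibonacci difference transform `F̂`: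
`(F̂x)₀ = x₀` and `(F̂x)ₙ = (fₙ/fₙ₊₁)xₙ − (fₙ₊₁/fₙ)xₙ₋₁` for `n ≥ 1`. -/
def Fhat (x : ℕ → ℝ) : ℕ → ℝ
  | 0 => x 0
  | n + 1 => (fibR (n + 1) / fibR (n + 2)) * x (n + 1) - (fibR (n + 2) / fibR (n + 1)) * x n

/-- The Fibonacci difference null space `c₀(F̂) = {x : (F̂x)ₙ → 0}`. -/
def c0FSet : Set (ℕ → ℝ) := {x | Tendsto (Fhat x) atTop (𝓝 0)}

/-- The Fibonacci difference convergent space `c(F̂) = {x : limₙ (F̂x)ₙ exists}`. -/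
def cFSet : Set (ℕ → ℝ) := {x | ∃ l : ℝ, Tendsto (Fhat x) atTop (𝓝 l)}
/-- The space `ℓ∞` of bounded real sequences. -/
def ellInfty : Set (ℕ → ℝ) := {y | ∃ M : ℝ, ∀ n : ℕ, |y n| ≤ M}

theorem fibR_pos (n : ℕ) : 0 < fibR n :=
  Nat.cast_pos.mpr (Nat.fib_pos.mpr n.succ_pos)

theorem natCast_le_fibR (n : ℕ) : (n : ℝ) ≤ fibR n := by
  have h := Nat.le_fib_add_one (n + 1)
  exact Nat.cast_le.mpr (by omega)

theorem Fhat_fibR_sq :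
    Fhat (fun k => fibR (k + 1) ^ 2) = fun n => if n = 0 then 1 else 0 := by
  funext n
  cases n with
  | zero => simp [Fhat, fibR]
  | succ n =>
    have h₁ := (fibR_pos (n + 1)).ne'
    have h₂ := (fibR_pos (n + 2)).ne'
    simp only [Fhat, Nat.succ_ne_zero, if_false]
    field_simp
    ring

theorem fibR_sq_notMem_ellInfty : (fun k => fibR (k + 1) ^ 2) ∉ ellInfty := by
  rintro ⟨M, hM⟩
  obtain ⟨n, hn⟩ := exists_nat_gt M
  have hle := (le_abs_self _).trans (hM n)
  have hfib := natCast_le_fibR (n + 1)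
  push_cast at hfib
  have hn₀ : (0 : ℝ) ≤ n := n.cast_nonneg
  nlinarith

/-- The sequence `xₖ = f_{k+1}²` satisfies `F̂x = e⁽⁰⁾ = (1,0,0,…)`, so `x ∈ c₀(F̂)`
but `x` is unbounded; consequently neither `c₀(F̂)` nor `c(F̂)` is contained in `ℓ∞`. -/
theorem c0F_cF_not_subset_ellInfty (x : ℕ → ℝ) (hx : ∀ k : ℕ, x k = fibR (k + 1) ^ 2) :
    (Fhat x = fun n => if n = 0 then 1 else 0) ∧
    x ∈ c0FSet ∧ x ∉ ellInfty ∧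
    ¬ c0FSet ⊆ ellInfty ∧ ¬ cFSet ⊆ ellInfty := by
  obtain rfl : x = fun k => fibR (k + 1) ^ 2 := funext hx
  have hmem : (fun k => fibR (k + 1) ^ 2) ∈ c0FSet := by
    change Tendsto (Fhat _) atTop (𝓝 0)
    rw [Fhat_fibR_sq]
    refine tendsto_const_nhds.congr' ?_
    filter_upwards [eventually_ne_atTop 0] with n hn
    simp [hn]
  exact ⟨Fhat_fibR_sq, hmem, fibR_sq_notMem_ellInfty,
    fun h => fibR_sq_notMem_ellInfty (h hmem),
    fun h => fibR_sq_notMem_ellInfty (h ⟨0, hmem⟩)⟩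
end
end

section
/- The inclusion c₀ ⊂ c₀(F̂) holds and is strict: every null sequence x satisfies (F̂x)ₙ → 0, and the sequence x = (f_{k+1}²) belongs to c₀(F̂) but not to c₀. -/
open Filter Finset Topology

noncomputable section

theorem one_le_fibR (n : ℕ) : 1 ≤ fibR n := by
  unfold fibR
  exact_mod_cast Nat.fib_pos.2 n.succ_pos

theorem fibR_add_two (n : ℕ) : fibR (n + 2) = fibR n + fibR (n + 1) := by
  unfold fibR
  exact_mod_cast Nat.fib_add_two

theorem fibR_le_fibR_succ (n : ℕ) : fibR n ≤ fibR (n + 1) := by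
  unfold fibR
  exact_mod_cast Nat.fib_le_fib_succ

theorem abs_Fhat_succ_le (x : ℕ → ℝ) (n : ℕ) :
    |Fhat x (n + 1)| ≤ |x (n + 1)| + 2 * |x n| := by
  have h₁ := fibR_pos (n + 1)
  have h₂ := fibR_pos (n + 2)
  have ha : fibR (n + 1) / fibR (n + 2) ≤ 1 :=
    (div_le_one h₂).2 (fibR_le_fibR_succ (n + 1))
  have hb : fibR (n + 2) / fibR (n + 1) ≤ 2 := by
    rw [div_le_iff₀ h₁]
    linarith [fibR_add_two n, fibR_le_fibR_succ n]
  calc |Fhat x (n + 1)|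
      ≤ |fibR (n + 1) / fibR (n + 2) * x (n + 1)| + |fibR (n + 2) / fibR (n + 1) * x n| :=
        abs_sub _ _
    _ = fibR (n + 1) / fibR (n + 2) * |x (n + 1)| + fibR (n + 2) / fibR (n + 1) * |x n| := by
        rw [abs_mul, abs_mul, abs_of_pos (div_pos h₁ h₂), abs_of_pos (div_pos h₂ h₁)]
    _ ≤ 1 * |x (n + 1)| + 2 * |x n| := by gcongr
    _ = |x (n + 1)| + 2 * |x n| := by rw [one_mul]

theorem tendsto_Fhat_zero {x : ℕ → ℝ} (hx : Tendsto x atTop (𝓝 0)) :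
    Tendsto (Fhat x) atTop (𝓝 0) := by
  rw [← tendsto_add_atTop_iff_nat 1]
  refine squeeze_zero_norm (abs_Fhat_succ_le x) ?_
  simpa using ((tendsto_add_atTop_iff_nat 1).2 hx).abs.add (hx.abs.const_mul 2)

theorem Fhat_sq_fibR_succ (n : ℕ) : Fhat (fun k => fibR (k + 1) ^ 2) (n + 1) = 0 := by
  have h₁ := (fibR_pos (n + 1)).ne'
  have h₂ := (fibR_pos (n + 2)).ne'
  simp only [Fhat]
  field_simp
  ring

theorem sq_fibR_mem_c0FSet : (fun k : ℕ => fibR (k + 1) ^ 2) ∈ c0FSet := by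
  refine (tendsto_add_atTop_iff_nat 1).1 ?_
  simp only [Fhat_sq_fibR_succ, tendsto_const_nhds]

theorem not_tendsto_sq_fibR_zero :
    ¬ Tendsto (fun k : ℕ => fibR (k + 1) ^ 2) atTop (𝓝 0) := fun h =>
  absurd (ge_of_tendsto' h fun k => one_le_pow₀ (one_le_fibR (k + 1))) (by norm_num)

/-- The inclusion `c₀ ⊂ c₀(F̂)` is strict: every null sequence `x` satisfies
`(F̂x)ₙ → 0`, and `x = (f_{k+1}²)` belongs to `c₀(F̂)` but not to `c₀`. -/
theorem c0_ssubset_c0F :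
    {x : ℕ → ℝ | Tendsto x atTop (𝓝 0)} ⊂ c0FSet ∧
    (fun k : ℕ => fibR (k + 1) ^ 2) ∈ c0FSet ∧
    ¬ Tendsto (fun k : ℕ => fibR (k + 1) ^ 2) atTop (𝓝 0) := by
  exact ⟨⟨fun _ hx => tendsto_Fhat_zero hx,
    fun h => not_tendsto_sq_fibR_zero (h sq_fibR_mem_c0FSet)⟩,
    sq_fibR_mem_c0FSet, not_tendsto_sq_fibR_zero⟩
end
end

section
/- The space c₀(F̂) is not solid: there exist sequences u ∈ c₀(F̂) and w with |wₖ| ≤ |uₖ| for all k but w ∉ c₀(F̂). Specifically, u = (f_{k+1}²) belongs to c₀(F̂), while w = ((−1)^{k+1} f_{k+1}²) satisfies (F̂w)ₖ = 2(−1)^{k+1} f_k f_{k+1} for all k ≥ 1, so w ∉ c₀(F̂). -/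
open Filter Finset Topology

noncomputable section

/-- A sequence space `λ` is solid if whenever `x ∈ λ` and `|uₖ| ≤ |xₖ|` for all `k`,
then `u ∈ λ`. -/
def Solid (lam : Set (ℕ → ℝ)) : Prop :=
  ∀ x ∈ lam, ∀ u : ℕ → ℝ, (∀ k : ℕ, |u k| ≤ |x k|) → u ∈ lam

theorem Fhat_eq_sub_mul {a x : ℕ → ℝ} (hx : ∀ k, x k = a k * fibR (k + 1) ^ 2) (n : ℕ) :
    Fhat x (n + 1) = (a (n + 1) - a n) * fibR (n + 1) * fibR (n + 2) := by
  have h₁ : fibR (n + 1) ≠ 0 := (zero_lt_one.trans_le (one_le_fibR _)).ne'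
  have h₂ : fibR (n + 2) ≠ 0 := (zero_lt_one.trans_le (one_le_fibR _)).ne'
  rw [Fhat, hx, hx]
  field_simp

/-- `c₀(F̂)` is not solid: `u = (f_{k+1}²) ∈ c₀(F̂)` and `w = ((−1)^{k+1} f_{k+1}²)`
satisfies `|wₖ| ≤ |uₖ|` for all `k` and `(F̂w)ₖ = 2(−1)^{k+1} f_k f_{k+1}` for `k ≥ 1`,
so `w ∉ c₀(F̂)`. -/
theorem c0F_not_solid (u w : ℕ → ℝ)
    (hu : ∀ k : ℕ, u k = fibR (k + 1) ^ 2)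
    (hw : ∀ k : ℕ, w k = (-1 : ℝ) ^ (k + 1) * fibR (k + 1) ^ 2) :
    u ∈ c0FSet ∧
    (∀ k : ℕ, |w k| ≤ |u k|) ∧
    (∀ k : ℕ, 1 ≤ k → Fhat w k = 2 * (-1 : ℝ) ^ (k + 1) * fibR k * fibR (k + 1)) ∧
    w ∉ c0FSet ∧
    ¬ Solid c0FSet := by
  have hu_mem : u ∈ c0FSet := by
    refine (tendsto_add_atTop_iff_nat 1).1 ?_
    have h : ∀ n, Fhat u (n + 1) = 0 := fun n => by
      rw [Fhat_eq_sub_mul (a := fun _ => 1) (by simpa using hu)]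
      simp
    simp only [h, tendsto_const_nhds]
  have hle : ∀ k, |w k| ≤ |u k| := fun k => by
    rw [hw, hu, abs_mul, abs_neg_one_pow, one_mul]
  have hFw : ∀ k : ℕ, 1 ≤ k →
      Fhat w k = 2 * (-1 : ℝ) ^ (k + 1) * fibR k * fibR (k + 1) := by
    rintro (_ | n) hk
    · omega
    · rw [Fhat_eq_sub_mul (a := fun k => (-1) ^ (k + 1)) hw]
      ring
  have hw_notMem : w ∉ c0FSet := fun h => by
    have h₀ : Tendsto (fun k => |Fhat w k|) atTop (𝓝 0) := by
      simpa using Tendsto.abs h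
    obtain ⟨k, hk, hk₁⟩ :=
      ((h₀.eventually (gt_mem_nhds zero_lt_one)).and (eventually_ge_atTop 1)).exists
    have h₁ := one_le_fibR k
    have h₂ := one_le_fibR (k + 1)
    rw [hFw k hk₁, abs_mul, abs_mul, abs_mul, abs_neg_one_pow, abs_two,
      abs_of_pos (zero_lt_one.trans_le h₁), abs_of_pos (zero_lt_one.trans_le h₂)] at hk
    nlinarith
  exact ⟨hu_mem, hle, hFw, hw_notMem, fun h => hw_notMem (h u hu_mem w hle)⟩
end
end

section
/- The space c(F̂) is not solid: there exist sequences u ∈ c(F̂) and w with |wₖ| ≤ |uₖ| for all k but w ∉ c(F̂). Specifically, u = (f_{k+1}²) belongs to c(F̂), while w = ((−1)^{k+1} f_{k+1}²) satisfies (F̂w)ₖ = 2(−1)^{k+1} f_k f_{k+1} for all k ≥ 1, so w ∉ c(F̂). -/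
open Filter Finset Topology

noncomputable section

/-- A sequence whose `F̂`-transform dominates the index in absolute value is not in `c(F̂)`. -/
theorem notMem_cFSet_of_natCast_le_abs {x : ℕ → ℝ} (h : ∀ k : ℕ, 1 ≤ k → (k : ℝ) ≤ |Fhat x k|) :
    x ∉ cFSet := by
  rintro ⟨l, hl⟩
  refine not_tendsto_nhds_of_tendsto_atTop ?_ |l| hl.abs
  refine tendsto_atTop_mono' _ ?_ (tendsto_natCast_atTop_atTop (R := ℝ))
  filter_upwards [eventually_ge_atTop 1] with k hk using h k hk

/-- `c(F̂)` is not solid: `u = (f_{k+1}²) ∈ c(F̂)` and `w = ((−1)^{k+1} f_{k+1}²)`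
satisfies `|wₖ| ≤ |uₖ|` for all `k` and `(F̂w)ₖ = 2(−1)^{k+1} f_k f_{k+1}` for `k ≥ 1`,
so `w ∉ c(F̂)`. -/
theorem cF_not_solid (u w : ℕ → ℝ)
    (hu : ∀ k : ℕ, u k = fibR (k + 1) ^ 2)
    (hw : ∀ k : ℕ, w k = (-1 : ℝ) ^ (k + 1) * fibR (k + 1) ^ 2) :
    u ∈ cFSet ∧
    (∀ k : ℕ, |w k| ≤ |u k|) ∧
    (∀ k : ℕ, 1 ≤ k → Fhat w k = 2 * (-1 : ℝ) ^ (k + 1) * fibR k * fibR (k + 1)) ∧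
    w ∉ cFSet ∧
    ¬ Solid cFSet := by
  have hmem : u ∈ cFSet := by
    refine ⟨0, (tendsto_add_atTop_iff_nat 1).1 ?_⟩
    have hzero : (fun n => Fhat u (n + 1)) = fun _ => 0 := by
      funext n
      have h₁ := (fibR_pos (n + 1)).ne'
      have h₂ := (fibR_pos (n + 2)).ne'
      simp only [Fhat, hu, show n + 1 + 1 = n + 2 from rfl]
      field_simp
      ring
    rw [hzero]
    exact tendsto_const_nhds
  have hle : ∀ k : ℕ, |w k| ≤ |u k| := fun k => by
    simp [hu, hw, abs_mul]
  have htrans : ∀ k : ℕ, 1 ≤ k →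
      Fhat w k = 2 * (-1 : ℝ) ^ (k + 1) * fibR k * fibR (k + 1) := by
    rintro (_ | n) hk
    · omega
    · have h₁ := (fibR_pos (n + 1)).ne'
      have h₂ := (fibR_pos (n + 2)).ne'
      simp only [Fhat, hw, show n + 1 + 1 = n + 2 from rfl]
      field_simp
      ring
  have hnot : w ∉ cFSet := by
    refine notMem_cFSet_of_natCast_le_abs fun k hk => ?_
    have h₁ := fibR_pos k
    have h₂ := fibR_pos (k + 1)
    have habs : |Fhat w k| = 2 * fibR k * fibR (k + 1) := by
      simp [htrans k hk, abs_mul, abs_of_pos h₁, abs_of_pos h₂]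
    rw [habs]
    nlinarith [natCast_le_fibR k, one_le_fibR (k + 1)]
  exact ⟨hmem, hle, htrans, hnot, fun hsolid => hnot (hsolid u hmem w hle)⟩
end
end
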